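/- Let $\mu \le_c \nu$ be probability measures on $\mathbb{R}$ in convex order with finite first moments. Then there exists a martingale coupling of $\mu$ and $\nu$: a probability measure $\pi$ on $\mathbb{R}^2$ with first marginal $\mu$, second marginal $\nu$, and such that for $\mu$-a.e. $x$, the disintegration $\pi_x$ satisfies $\int y \, d\pi_x(y) = x$. -/

import Mathlib

open MeasureTheory ProbabilityTheory
open Filter Topology
open scoped BoundedContinuousFunction CompactlySupported

lemma smc_extend {P E : Type*} [AddCommGroup P] [Module ℝ P] [AddCommGroup E] [Module ℝ E]
    (T : P →ₗ[ℝ] E) (L : P →ₗ[ℝ] ℝ) (S : PointedCone ℝ E)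
    (hpos : ∀ p, T p ∈ S → 0 ≤ L p) (hdom : ∀ e, ∃ p, T p + e ∈ S) :
    ∃ Λ : E →ₗ[ℝ] ℝ, (∀ p, Λ (T p) = L p) ∧ ∀ x ∈ S, 0 ≤ Λ x := by
  have hker : ∀ p, T p = 0 → L p = 0 := by
    intro p hp
    have h1 := hpos p (by rw [hp]; exact S.zero_mem)
    have h2 := hpos (-p) (by rw [map_neg, hp, neg_zero]; exact S.zero_mem)
    rw [map_neg] at h2
    linarith
  obtain ⟨s, hs⟩ := T.rangeRestrict.exists_rightInverse_of_surjective T.range_rangeRestrict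
  have hTs : ∀ x : LinearMap.range T, T (s x) = x := by
    intro x
    have := congrArg (fun g => ((g x : LinearMap.range T) : E)) hs
    simpa using this
  have hLs : ∀ (x : LinearMap.range T) p, T p = x → L (s x) = L p := by
    intro x p hp
    have := hker (s x - p) (by rw [map_sub, hTs, hp, sub_self])
    rw [map_sub] at this
    linarith
  obtain ⟨g, hg1, hg2⟩ := riesz_extension S ⟨LinearMap.range T, L.comp s⟩
    (by
      intro x hx
      have hx' : T (s x) ∈ S := by rw [hTs]; exact hx
      exact hpos _ hx')
    (by
      intro y
      obtain ⟨p, hp⟩ := hdom y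
      exact ⟨⟨T p, p, rfl⟩, hp⟩)
  refine ⟨g, fun p => ?_, hg2⟩
  have := hg1 ⟨T p, p, rfl⟩
  rw [this]
  exact hLs ⟨T p, p, rfl⟩ p rfl

lemma smc_integrable (μ : Measure ℝ) [IsProbabilityMeasure μ]
    (hμ : Integrable (fun y => y) μ) (g : ℝ → ℝ) (hg : AEStronglyMeasurable g μ) (C : ℝ)
    (hC : ∀ x, |g x| ≤ C * (1 + |x|)) : Integrable g μ := by
  refine Integrable.mono' (g := fun x => C * (1 + |x|)) ?_ hg (ae_of_all _ fun x => by simpa using hC x)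
  exact ((integrable_const _).add hμ.abs).const_mul C

lemma smc_integrable_w (μ : Measure ℝ) [IsProbabilityMeasure μ]
    (hμ : Integrable (fun y => y) μ) (u : ℝ →ᵇ ℝ) :
    Integrable (fun x => (1 + |x|) * u x) μ := by
  refine smc_integrable μ hμ _ (by fun_prop) ‖u‖ fun x => ?_
  rw [abs_mul, abs_of_pos (by positivity), mul_comm]
  have := u.norm_coe_le_norm x
  rw [Real.norm_eq_abs] at this
  gcongr

lemma smc_pos (μ ν : Measure ℝ)
    [IsProbabilityMeasure μ] [IsProbabilityMeasure ν]
    (hμ : Integrable (fun y => y) μ) (hν : Integrable (fun y => y) ν)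
    (hconv : ∀ f : ℝ → ℝ, ConvexOn ℝ Set.univ f → Integrable f μ → Integrable f ν →
      ∫ x, f x ∂μ ≤ ∫ x, f x ∂ν) (u v h : ℝ →ᵇ ℝ)
    (hp : ∀ x y, 0 ≤ (1 + |x|) * u x + (1 + |y|) * v y + h x * (y - x)) :
    0 ≤ ∫ x, (1 + |x|) * u x ∂μ + ∫ y, (1 + |y|) * v y ∂ν := by
  set g : ℝ → ℝ := fun y => ⨆ x, (-((1 + |x|) * u x) - h x * (y - x)) with hg
  have hbdd : ∀ y, BddAbove (Set.range fun x => (-((1 + |x|) * u x) - h x * (y - x))) := by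
    intro y
    refine ⟨(1 + |y|) * v y, ?_⟩
    rintro _ ⟨x, rfl⟩
    have := hp x y
    simp only
    linarith
  have hle : ∀ x y, -((1 + |x|) * u x) - h x * (y - x) ≤ g y := fun x y => le_ciSup (hbdd y) x
  have hgv : ∀ y, g y ≤ (1 + |y|) * v y := fun y => ciSup_le fun x => by
    have := hp x y
    linarith
  have hgc : ConvexOn ℝ Set.univ g := by
    refine ⟨convex_univ, fun y _ z _ a b ha hb hab => ciSup_le fun x => ?_⟩
    have h1 := mul_le_mul_of_nonneg_left (hle x y) ha
    have h2 := mul_le_mul_of_nonneg_left (hle x z) hb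
    simp only [smul_eq_mul]
    have hb' : b = 1 - a := by linarith
    subst hb'
    nlinarith
  have hgm : Continuous g := by
    have := hgc.continuousOn isOpen_univ
    rwa [continuousOn_univ] at this
  have hv : ∀ y, |v y| ≤ ‖v‖ := fun y => by simpa using v.norm_coe_le_norm y
  have hbound : ∀ y, |g y| ≤ (‖v‖ + |u 0| + |h 0|) * (1 + |y|) := by
    intro y
    have h1 := hle 0 y
    have h2 := hgv y
    have h3 := (abs_le.1 (hv y)).2
    simp only [abs_zero, add_zero, one_mul, sub_zero] at h1
    have h4 : (1 + |y|) * v y ≤ (1 + |y|) * ‖v‖ := by gcongr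
    have h5 := le_abs_self (u 0)
    have h6 : h 0 * y ≤ |h 0| * |y| := by rw [← abs_mul]; exact le_abs_self _
    have := abs_nonneg y
    have := abs_nonneg (u 0)
    have := abs_nonneg (h 0)
    have := norm_nonneg v
    have : 0 ≤ |u 0| * |y| := by positivity
    have : 0 ≤ |h 0| * |y| := by positivity
    have : 0 ≤ ‖v‖ * |y| := by positivity
    rw [abs_le]
    constructor <;> nlinarith
  have hgμ := smc_integrable μ hμ g hgm.aestronglyMeasurable _ hbound
  have hgν := smc_integrable ν hν g hgm.aestronglyMeasurable _ hbound
  have k1 := hconv g hgc hgμ hgν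
  have k2 : ∫ y, g y ∂ν ≤ ∫ y, (1 + |y|) * v y ∂ν :=
    integral_mono hgν (smc_integrable_w ν hν v) hgv
  have k3 : ∫ x, -((1 + |x|) * u x) ∂μ ≤ ∫ x, g x ∂μ := by
    refine integral_mono (smc_integrable_w μ hμ u).neg hgμ fun x => ?_
    simpa using hle x x
  rw [integral_neg] at k3
  linarith

/-- Functions on the plane of at most linear growth. -/
def smcE : Submodule ℝ (ℝ × ℝ → ℝ) where
  carrier := {f | ∃ C, ∀ p, |f p| ≤ C * (1 + |p.1| + |p.2|)}
  add_mem' := by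
    rintro f g ⟨C, hC⟩ ⟨D, hD⟩
    refine ⟨C + D, fun p => ?_⟩
    have := abs_add_le (f p) (g p)
    have := hC p
    have := hD p
    simp only [Pi.add_apply]
    nlinarith
  zero_mem' := ⟨0, by simp⟩
  smul_mem' := by
    rintro c f ⟨C, hC⟩
    refine ⟨|c| * C, fun p => ?_⟩
    simp only [Pi.smul_apply, smul_eq_mul, abs_mul, mul_assoc]
    exact mul_le_mul_of_nonneg_left (hC p) (abs_nonneg c)

lemma smc_mem (u v h : ℝ →ᵇ ℝ) :
    (fun p : ℝ × ℝ => (1 + |p.1|) * u p.1 + (1 + |p.2|) * v p.2 + h p.1 * (p.2 - p.1)) ∈ smcE := by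
  refine ⟨‖u‖ + ‖v‖ + ‖h‖, fun p => ?_⟩
  have b : ∀ (w : ℝ →ᵇ ℝ) y, |w y| ≤ ‖w‖ := fun w y => by simpa using w.norm_coe_le_norm y
  have a1 : |(1 + |p.1|) * u p.1| ≤ (1 + |p.1|) * ‖u‖ := by
    rw [abs_mul, abs_of_pos (by positivity)]; gcongr; exact b _ _
  have a2 : |(1 + |p.2|) * v p.2| ≤ (1 + |p.2|) * ‖v‖ := by
    rw [abs_mul, abs_of_pos (by positivity)]; gcongr; exact b _ _
  have a3 : |h p.1 * (p.2 - p.1)| ≤ ‖h‖ * (|p.2| + |p.1|) := by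
    rw [abs_mul]; gcongr
    · exact b _ _
    · exact abs_sub _ _
  have := abs_add_three ((1 + |p.1|) * u p.1) ((1 + |p.2|) * v p.2) (h p.1 * (p.2 - p.1))
  have := mul_nonneg (norm_nonneg u) (abs_nonneg p.2)
  have := mul_nonneg (norm_nonneg v) (abs_nonneg p.1)
  have := norm_nonneg h
  nlinarith

/-- The parametrization of elementary functions. -/
def smcT : ((ℝ →ᵇ ℝ) × (ℝ →ᵇ ℝ) × (ℝ →ᵇ ℝ)) →ₗ[ℝ] smcE where
  toFun q := ⟨_, smc_mem q.1 q.2.1 q.2.2⟩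
  map_add' q r := by
    ext p
    simp
    ring
  map_smul' c q := by
    ext p
    simp
    ring

/-- Nonnegative functions. -/
def smcS : PointedCone ℝ smcE where
  carrier := {f | ∀ p, 0 ≤ f.1 p}
  add_mem' := by
    intro f g hf hg p
    exact add_nonneg (hf p) (hg p)
  zero_mem' := fun p => le_refl _
  smul_mem' := by
    intro c f hf p
    exact mul_nonneg c.2 (hf p)

lemma smc_functional (μ ν : Measure ℝ)
    [IsProbabilityMeasure μ] [IsProbabilityMeasure ν]
    (hμ : Integrable (fun y => y) μ) (hν : Integrable (fun y => y) ν)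
    (hconv : ∀ f : ℝ → ℝ, ConvexOn ℝ Set.univ f → Integrable f μ → Integrable f ν →
      ∫ x, f x ∂μ ≤ ∫ x, f x ∂ν) :
    ∃ Λ : smcE →ₗ[ℝ] ℝ, (∀ u v h : ℝ →ᵇ ℝ, Λ (smcT (u, v, h)) =
      ∫ x, (1 + |x|) * u x ∂μ + ∫ y, (1 + |y|) * v y ∂ν) ∧
      ∀ f : smcE, (∀ p, 0 ≤ f.1 p) → 0 ≤ Λ f := by
  let L : ((ℝ →ᵇ ℝ) × (ℝ →ᵇ ℝ) × (ℝ →ᵇ ℝ)) →ₗ[ℝ] ℝ :=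
    { toFun := fun q => ∫ x, (1 + |x|) * q.1 x ∂μ + ∫ y, (1 + |y|) * q.2.1 y ∂ν
      map_add' := by
        intro q r
        have e1 := integral_add (smc_integrable_w μ hμ q.1) (smc_integrable_w μ hμ r.1)
        have e2 := integral_add (smc_integrable_w ν hν q.2.1) (smc_integrable_w ν hν r.2.1)
        simp only [Prod.fst_add, Prod.snd_add, BoundedContinuousFunction.coe_add, Pi.add_apply,
          mul_add] at e1 e2 ⊢
        rw [e1, e2]
        ring
      map_smul' := by
        intro c q
        have e1 := integral_const_mul (μ := μ) c (fun x => (1 + |x|) * q.1 x)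
        have e2 := integral_const_mul (μ := ν) c (fun x => (1 + |x|) * q.2.1 x)
        simp only [Prod.smul_fst, Prod.smul_snd, BoundedContinuousFunction.coe_smul, smul_eq_mul,
          RingHom.id_apply, mul_left_comm _ c] at e1 e2 ⊢
        rw [e1, e2]
        ring }
  obtain ⟨Λ, h1, h2⟩ := smc_extend smcT L smcS
    (by
      rintro ⟨u, v, h⟩ hp
      exact smc_pos μ ν hμ hν hconv u v h (fun x y => hp (x, y)))
    (by
      rintro ⟨f, C, hC⟩
      refine ⟨(BoundedContinuousFunction.const ℝ |C|, BoundedContinuousFunction.const ℝ |C|, 0), ?_⟩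
      intro p
      have := (abs_le.1 (hC p)).1
      have := le_abs_self C
      have := abs_nonneg C
      have := abs_nonneg p.1
      have := abs_nonneg p.2
      simp [smcT]
      nlinarith)
  exact ⟨Λ, fun u v h => h1 (u, v, h), h2⟩

/-- Cutoff. -/
noncomputable def smct (n : ℕ) : ℝ →ᵇ ℝ :=
  BoundedContinuousFunction.ofNormedAddCommGroup (fun x : ℝ => min 1 (max 0 (|x| - n)))
    (by fun_prop) 1 (fun x => by
      rw [Real.norm_eq_abs, abs_of_nonneg (by positivity)]
      exact min_le_left _ _)

lemma smct_apply (n : ℕ) (x : ℝ) : smct n x = min 1 (max 0 (|x| - n)) := rfl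

lemma smct_nonneg (n : ℕ) (x : ℝ) : 0 ≤ smct n x := by rw [smct_apply]; positivity

lemma smct_le_one (n : ℕ) (x : ℝ) : smct n x ≤ 1 := by rw [smct_apply]; exact min_le_left _ _

lemma smct_mono (n : ℕ) (x y : ℝ) (h : |x| ≤ |y|) : smct n x ≤ smct n y := by
  rw [smct_apply, smct_apply]; gcongr

lemma smct_eq_one (n : ℕ) (x : ℝ) (h : (n : ℝ) + 1 ≤ |x|) : smct n x = 1 := by
  rw [smct_apply, min_eq_left]
  exact le_max_of_le_right (by linarith)

lemma smct_tendsto (x : ℝ) : Tendsto (fun n => smct n x) atTop (𝓝 0) := by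
  refine tendsto_const_nhds.congr' ?_
  obtain ⟨N, hN⟩ := exists_nat_ge |x|
  filter_upwards [eventually_ge_atTop N] with n hn
  have : (N : ℝ) ≤ n := by exact_mod_cast hn
  rw [smct_apply, max_eq_left (by linarith)]
  simp

lemma smct_int (μ : Measure ℝ) [IsProbabilityMeasure μ]
    (hμ : Integrable (fun y => y) μ) :
    Tendsto (fun n => ∫ x, (1 + |x|) * smct n x ∂μ) atTop (𝓝 0) := by
  have := tendsto_integral_of_dominated_convergence (μ := μ)
    (F := fun n x => (1 + |x|) * smct n x) (f := fun x => 0) (fun x => 1 + |x|)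
    (fun n => (smc_integrable_w μ hμ (smct n)).aestronglyMeasurable)
    ((integrable_const _).add hμ.abs)
    (fun n => ae_of_all _ fun x => by
      rw [Real.norm_eq_abs, abs_of_nonneg (mul_nonneg (by positivity) (smct_nonneg n x))]
      exact mul_le_of_le_one_right (by positivity) (smct_le_one n x))
    (ae_of_all _ fun x => by simpa using (smct_tendsto x).const_mul (1 + |x|))
  simpa using this

/-- Planar cutoff. -/
noncomputable def smcchi (n : ℕ) (p : ℝ × ℝ) : ℝ := (1 - smct n p.1) * (1 - smct n p.2)

lemma smcchi_nonneg (n : ℕ) (p : ℝ × ℝ) : 0 ≤ smcchi n p :=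
  mul_nonneg (by linarith [smct_le_one n p.1]) (by linarith [smct_le_one n p.2])

lemma smcchi_le_one (n : ℕ) (p : ℝ × ℝ) : smcchi n p ≤ 1 :=
  mul_le_one₀ (by linarith [smct_nonneg n p.1]) (by linarith [smct_le_one n p.2])
    (by linarith [smct_nonneg n p.2])

lemma smcchi_tendsto (p : ℝ × ℝ) : Tendsto (fun n => smcchi n p) atTop (𝓝 1) := by
  have := ((smct_tendsto p.1).const_sub 1).mul ((smct_tendsto p.2).const_sub 1)
  simpa [smcchi] using this

lemma smcchi_bound (n : ℕ) (p : ℝ × ℝ) : (1 + |p.1| + |p.2|) * (1 - smcchi n p) ≤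
    4 * ((1 + |p.1|) * smct n p.1 + (1 + |p.2|) * smct n p.2) := by
  have key : ∀ x y : ℝ, |x| ≤ |y| → (1 + |x| + |y|) * (smct n x + smct n y) ≤
      4 * ((1 + |y|) * smct n y) := by
    intro x y hxy
    have h1 := smct_mono n x y hxy
    have h2 := smct_nonneg n y
    have h3 := smct_nonneg n x
    have : (1 + |x| + |y|) * (smct n x + smct n y) ≤ (2 * (1 + |y|)) * (2 * smct n y) := by
      have := abs_nonneg x
      have := abs_nonneg y
      apply mul_le_mul <;> linarith
    linarith
  have h1 := smct_nonneg n p.1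
  have h2 := smct_nonneg n p.2
  have h0 : 1 - smcchi n p ≤ smct n p.1 + smct n p.2 := by
    unfold smcchi; nlinarith
  have h3 := mul_le_mul_of_nonneg_left h0 (show 0 ≤ 1 + |p.1| + |p.2| by positivity)
  have h4 : 0 ≤ (1 + |p.1|) * smct n p.1 := by positivity
  have h5 : 0 ≤ (1 + |p.2|) * smct n p.2 := by positivity
  rcases le_total |p.1| |p.2| with h | h
  · have := key _ _ h
    linarith
  · have := key _ _ h
    nlinarith

lemma smcchi_cont (n : ℕ) : Continuous (smcchi n) := by
  unfold smcchi
  fun_prop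

/-- Truncation of a continuous function. -/
noncomputable def smctrunc (f : ℝ × ℝ → ℝ) (hf : Continuous f) (n : ℕ) : C_c(ℝ × ℝ, ℝ) where
  toFun p := f p * smcchi n p
  continuous_toFun := hf.mul (smcchi_cont n)
  hasCompactSupport' := by
    refine HasCompactSupport.intro
      ((isCompact_Icc (a := -((n : ℝ) + 1)) (b := n + 1)).prod
        (isCompact_Icc (a := -((n : ℝ) + 1)) (b := n + 1))) fun p hp => ?_
    rw [Set.mem_prod, Set.mem_Icc, Set.mem_Icc, ← abs_le, ← abs_le, not_and_or, not_le, not_le] at hp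
    rcases hp with hp | hp
    · simp [smcchi, smct_eq_one n _ hp.le]
    · simp [smcchi, smct_eq_one n _ hp.le]

lemma smcCc_mem (f : C_c(ℝ × ℝ, ℝ)) : (f : ℝ × ℝ → ℝ) ∈ smcE := by
  obtain ⟨C, hC⟩ := f.hasCompactSupport.exists_bound_of_continuous f.continuous
  refine ⟨C, fun p => (hC p).trans ?_⟩
  have : 0 ≤ C := (norm_nonneg _).trans (hC p)
  have := mul_nonneg this (abs_nonneg p.1)
  have := mul_nonneg ‹0 ≤ C› (abs_nonneg p.2)
  nlinarith

/-- Inclusion of compactly supported functions. -/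
def smcI : C_c(ℝ × ℝ, ℝ) →ₗ[ℝ] smcE where
  toFun f := ⟨f, smcCc_mem f⟩
  map_add' _ _ := rfl
  map_smul' _ _ := rfl

lemma smc_repr (μ ν : Measure ℝ)
    [IsProbabilityMeasure μ] [IsProbabilityMeasure ν]
    (hμ : Integrable (fun y => y) μ) (hν : Integrable (fun y => y) ν)
    (Λ : smcE →ₗ[ℝ] ℝ) (hΛ : ∀ u v h : ℝ →ᵇ ℝ, Λ (smcT (u, v, h)) =
      ∫ x, (1 + |x|) * u x ∂μ + ∫ y, (1 + |y|) * v y ∂ν)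
    (hpos : ∀ f : smcE, (∀ p, 0 ≤ f.1 p) → 0 ≤ Λ f) :
    ∃ π : Measure (ℝ × ℝ), Integrable (fun p : ℝ × ℝ => 1 + |p.1| + |p.2|) π ∧
      ∀ f : smcE, Continuous f.1 → ∫ p, f.1 p ∂π = Λ f := by
  have hmono : ∀ f g : smcE, (∀ p, f.1 p ≤ g.1 p) → Λ f ≤ Λ g := by
    intro f g h
    have := hpos (g - f) (fun p => sub_nonneg.2 (h p))
    rw [map_sub] at this
    linarith
  let R : C_c(ℝ × ℝ, ℝ) →ₚ[ℝ] ℝ := PositiveLinearMap.mk₀ (Λ.comp smcI) (fun f hf =>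
    hpos _ (fun p => hf p))
  let π := RealRMK.rieszMeasure R
  have hπ : ∀ f : C_c(ℝ × ℝ, ℝ), ∫ p, f p ∂π = Λ (smcI f) := fun f =>
    RealRMK.integral_rieszMeasure R f
  have hlim : ∀ f : smcE, ∀ hf : Continuous f.1,
      Tendsto (fun n => ∫ p, f.1 p * smcchi n p ∂π) atTop (𝓝 (Λ f)) := by
    intro f hf
    obtain ⟨C, hC⟩ := f.2
    have hlim0 : Tendsto (fun n => (4 * C) * (∫ x, (1 + |x|) * smct n x ∂μ +
        ∫ y, (1 + |y|) * smct n y ∂ν)) atTop (𝓝 0) := by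
      simpa using ((smct_int μ hμ).add (smct_int ν hν)).const_mul (4 * C)
    have e : ∀ n, Λ (smcT ((4 * C) • (smct n, smct n, 0))) =
        (4 * C) * (∫ x, (1 + |x|) * smct n x ∂μ + ∫ y, (1 + |y|) * smct n y ∂ν) := by
      intro n
      rw [map_smul, map_smul, hΛ, smul_eq_mul]
    have hpt : ∀ n p, |f.1 p - f.1 p * smcchi n p| ≤
        (smcT ((4 * C) • (smct n, smct n, 0))).1 p := by
      intro n p
      have h1 : |f.1 p - f.1 p * smcchi n p| = |f.1 p| * (1 - smcchi n p) := by
        rw [← mul_one_sub, abs_mul, abs_of_nonneg (a := 1 - smcchi n p)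
          (by linarith [smcchi_le_one n p])]
      have hC0 : 0 ≤ C := by
        have := (abs_nonneg _).trans (hC (0, 0))
        simpa using this
      have h2 := mul_le_mul_of_nonneg_right (hC p)
        (show 0 ≤ 1 - smcchi n p by linarith [smcchi_le_one n p])
      have h3 := mul_le_mul_of_nonneg_left (smcchi_bound n p) hC0
      rw [h1]
      simp [smcT]
      nlinarith
    have hd : ∀ n, |∫ p, f.1 p * smcchi n p ∂π - Λ f| ≤ (4 * C) * (∫ x, (1 + |x|) * smct n x ∂μ +
        ∫ y, (1 + |y|) * smct n y ∂ν) := by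
      intro n
      have h1 : ∫ p, f.1 p * smcchi n p ∂π = Λ (smcI (smctrunc f.1 hf n)) :=
        hπ (smctrunc f.1 hf n)
      rw [h1, ← e n, abs_le, neg_le, ← map_sub, ← map_neg]
      refine ⟨hmono _ _ fun p => ?_, hmono _ _ fun p => ?_⟩
      · refine le_trans ?_ (hpt n p)
        have : (-(smcI (smctrunc f.1 hf n) - f)).1 p = f.1 p - f.1 p * smcchi n p := by
          change -(f.1 p * smcchi n p - f.1 p) = _
          ring
        rw [this]
        exact le_abs_self _
      · refine le_trans ?_ (hpt n p)
        have : (smcI (smctrunc f.1 hf n) - f).1 p = -(f.1 p - f.1 p * smcchi n p) := by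
          change (f.1 p * smcchi n p - f.1 p) = _
          ring
        rw [this]
        exact neg_le_abs _
    rw [tendsto_iff_norm_sub_tendsto_zero]
    exact squeeze_zero (fun n => norm_nonneg _) hd hlim0
  let W : smcE := ⟨fun p => 1 + |p.1| + |p.2|, 1, fun p => by
    rw [one_mul, abs_of_nonneg (by positivity)]⟩
  have hWc : Continuous W.1 := by
    change Continuous (fun p : ℝ × ℝ => 1 + |p.1| + |p.2|)
    fun_prop
  have hW : Integrable W.1 π := by
    refine ⟨hWc.aestronglyMeasurable, ?_⟩
    have hint : ∀ n, Integrable (fun p => W.1 p * smcchi n p) π := fun n =>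
      (smctrunc W.1 hWc n).continuous.integrable_of_hasCompactSupport
        (smctrunc W.1 hWc n).hasCompactSupport
    have hnn : ∀ p, 0 ≤ W.1 p := fun p => by
      change 0 ≤ 1 + |p.1| + |p.2|
      positivity
    have hF : ∫⁻ p, ‖W.1 p‖ₑ ∂π ≤ liminf (fun n => ∫⁻ p, ENNReal.ofReal (W.1 p * smcchi n p) ∂π)
        atTop := by
      refine le_trans (lintegral_mono fun p => ?_) (lintegral_liminf_le fun n => ?_)
      · have : Tendsto (fun n => ENNReal.ofReal (W.1 p * smcchi n p)) atTop
            (𝓝 (ENNReal.ofReal (W.1 p))) := by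
          apply ENNReal.tendsto_ofReal
          simpa using (smcchi_tendsto p).const_mul (W.1 p)
        rw [this.liminf_eq, Real.enorm_eq_ofReal (hnn p)]
      · exact (hWc.mul (smcchi_cont n)).measurable.ennreal_ofReal
    have hL : Tendsto (fun n => ∫⁻ p, ENNReal.ofReal (W.1 p * smcchi n p) ∂π) atTop
        (𝓝 (ENNReal.ofReal (Λ W))) := by
      refine (ENNReal.tendsto_ofReal (hlim W hWc)).congr fun n => ?_
      exact ofReal_integral_eq_lintegral_ofReal (hint n)
        (ae_of_all _ fun p => mul_nonneg (hnn p) (smcchi_nonneg n p))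
    rw [hL.liminf_eq] at hF
    exact hF.trans_lt ENNReal.ofReal_lt_top
  refine ⟨π, hW, fun f hf => ?_⟩
  refine tendsto_nhds_unique ?_ (hlim f hf)
  obtain ⟨C, hC⟩ := f.2
  refine tendsto_integral_of_dominated_convergence (fun p => C * W.1 p)
    (fun n => (hf.mul (smcchi_cont n)).aestronglyMeasurable) (hW.const_mul C)
    (fun n => ae_of_all _ fun p => ?_) (ae_of_all _ fun p => ?_)
  · rw [norm_mul, Real.norm_eq_abs, Real.norm_eq_abs, abs_of_nonneg (smcchi_nonneg n p)]
    exact (mul_le_of_le_one_right (abs_nonneg _) (smcchi_le_one n p)).trans (hC p)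
  · simpa using (smcchi_tendsto p).const_mul (f.1 p)

/-- Bounded continuous function divided by the weight. -/
noncomputable def smcdiv (u : ℝ →ᵇ ℝ) : ℝ →ᵇ ℝ :=
  BoundedContinuousFunction.ofNormedAddCommGroup (fun x : ℝ => u x / (1 + |x|))
    (u.continuous.div (by fun_prop) (fun x => by positivity)) ‖u‖ (fun x => by
      rw [norm_div, Real.norm_eq_abs (1 + |x|), abs_of_nonneg (by positivity)]
      refine (div_le_self (norm_nonneg _) (by linarith [abs_nonneg x])).trans
        (u.norm_coe_le_norm x))

lemma smcdiv_apply (u : ℝ →ᵇ ℝ) (x : ℝ) : (1 + |x|) * smcdiv u x = u x := by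
  change (1 + |x|) * (u x / (1 + |x|)) = u x
  have : 1 + |x| ≠ 0 := by positivity
  field_simp

/-- Strassen's theorem (one step): if `μ ≤ ν` in convex order, then there is a martingale
coupling `π = μ ⊗ₘ κ` of `μ` and `ν`, i.e. a coupling whose disintegration `κ` satisfies
`∫ y dκ(x) = x` for `μ`-a.e. `x`. -/
theorem exists_martingale_coupling (μ ν : Measure ℝ)
    [IsProbabilityMeasure μ] [IsProbabilityMeasure ν]
    (hμ : Integrable (fun y => y) μ) (hν : Integrable (fun y => y) ν)
    (hconv : ∀ f : ℝ → ℝ, ConvexOn ℝ Set.univ f → Integrable f μ → Integrable f ν →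
      ∫ x, f x ∂μ ≤ ∫ x, f x ∂ν) :
    ∃ κ : Kernel ℝ ℝ, IsMarkovKernel κ ∧
      (μ.compProd κ).map Prod.fst = μ ∧
      (μ.compProd κ).map Prod.snd = ν ∧
      ∀ᵐ x ∂μ, ∫ y, y ∂(κ x) = x := by
  obtain ⟨Λ, hΛ, hpos⟩ := smc_functional μ ν hμ hν hconv
  obtain ⟨π, hW, hπ⟩ := smc_repr μ ν hμ hν Λ hΛ hpos
  have hT : ∀ u v h : ℝ →ᵇ ℝ,
      ∫ p, ((1 + |p.1|) * u p.1 + (1 + |p.2|) * v p.2 + h p.1 * (p.2 - p.1)) ∂π =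
      ∫ x, (1 + |x|) * u x ∂μ + ∫ y, (1 + |y|) * v y ∂ν := by
    intro u v h
    rw [← hΛ u v h, ← hπ _ (by simp only [smcT, LinearMap.coe_mk, AddHom.coe_mk]; fun_prop)]
    rfl
  have hfin : IsFiniteMeasure π := by
    have h1 : Integrable (fun _ : ℝ × ℝ => (1 : ℝ)) π :=
      hW.mono' (by fun_prop) (ae_of_all _ fun p => by
        simp only [norm_one]
        linarith [abs_nonneg p.1, abs_nonneg p.2])
    rw [integrable_const_iff] at h1
    simpa using h1
  have hfst : π.fst = μ := by
    refine ext_of_forall_integral_eq_of_IsFiniteMeasure fun u => ?_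
    have := hT (smcdiv u) 0 0
    simp only [smcdiv_apply, BoundedContinuousFunction.coe_zero, Pi.zero_apply, mul_zero, zero_mul,
      add_zero, integral_zero] at this
    rw [← this, Measure.fst, integral_map (by fun_prop) (by fun_prop)]
  have hsnd : π.snd = ν := by
    refine ext_of_forall_integral_eq_of_IsFiniteMeasure fun u => ?_
    have := hT 0 (smcdiv u) 0
    simp only [smcdiv_apply, BoundedContinuousFunction.coe_zero, Pi.zero_apply, mul_zero, zero_mul,
      add_zero, zero_add, integral_zero] at this
    rw [← this, Measure.snd, integral_map (by fun_prop) (by fun_prop)]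
  have hdis : μ.compProd π.condKernel = π := by
    rw [← hfst]
    exact π.disintegrate π.condKernel
  refine ⟨π.condKernel, inferInstance, ?_, ?_, ?_⟩
  · rw [hdis]; exact hfst
  · rw [hdis]; exact hsnd
  have hy : Integrable (fun p : ℝ × ℝ => p.2) π :=
    hW.mono' (by fun_prop) (ae_of_all _ fun p => by
      rw [Real.norm_eq_abs]
      linarith [abs_nonneg p.1, abs_nonneg p.2])
  have hx : Integrable (fun p : ℝ × ℝ => p.1) π :=
    hW.mono' (by fun_prop) (ae_of_all _ fun p => by
      rw [Real.norm_eq_abs]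
      linarith [abs_nonneg p.1, abs_nonneg p.2])
  have hm : Integrable (fun x => ∫ y, y ∂(π.condKernel x)) μ := by
    have h := hy
    rw [← hdis] at h
    rw [Measure.compProd] at h
    simpa using h.integral_compProd
  have hyx : ∀ᵐ x ∂μ, Integrable (fun y => y) (π.condKernel x) := by
    have h := hy
    rw [← hdis] at h
    exact ((Measure.integrable_compProd_iff h.aestronglyMeasurable).1 h).1
  have hz := ae_eq_zero_of_integral_contDiff_smul_eq_zero (hm.sub hμ).locallyIntegrable (by
    intro g hg hgc
    obtain ⟨C, hC⟩ := hgc.exists_bound_of_continuous hg.continuous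
    let h : ℝ →ᵇ ℝ := BoundedContinuousFunction.ofNormedAddCommGroup g hg.continuous C hC
    have h0 := hT 0 0 h
    simp only [BoundedContinuousFunction.coe_zero, Pi.zero_apply, mul_zero,
      add_zero, zero_add, integral_zero] at h0
    have hi : Integrable (fun p : ℝ × ℝ => h p.1 * (p.2 - p.1)) π :=
      (hy.sub hx).bdd_mul (c := C) (by fun_prop) (ae_of_all _ fun p => hC p.1)
    have hi' := hi
    rw [← hdis] at hi'
    have h1 := Measure.integral_compProd hi'
    rw [hdis, h0] at h1
    rw [h1]
    refine integral_congr_ae ?_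
    filter_upwards [hyx] with x hx
    simp only [integral_const_mul, Pi.sub_apply, smul_eq_mul]
    rw [integral_sub hx (integrable_const _)]
    simp [h])
  filter_upwards [hz] with x hx
  simpa [sub_eq_zero] using hx
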